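/- Let α > 1 and p > α. Then L_α(p) ≤ ((α−1)^p / p^p) · [ 2^{1+α} Γ(p+1) + (2 ln 2)^p / (p−α) ]. -/

import Mathlib

open MeasureTheory Real Set Filter Topology
open scoped ENNReal

/-- `L_α(p) = ∫_0^1 |1 − r^{(α−1)/p}|^p / (1−r)^{1+α} dr`. -/
noncomputable def Lfun (α p : ℝ) : ℝ :=
  ∫ r in Set.Ioo (0 : ℝ) 1, |1 - r ^ ((α - 1) / p)| ^ p / (1 - r) ^ (1 + α)

theorem image_exp_neg_Ioi_zero :
    (fun x : ℝ => Real.exp (-x)) '' Set.Ioi 0 = Set.Ioo 0 1 := by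
  ext r
  simp only [Set.mem_image, Set.mem_Ioi, Set.mem_Ioo]
  constructor
  · rintro ⟨x, hx, rfl⟩
    exact ⟨Real.exp_pos _, Real.exp_zero ▸ Real.exp_lt_exp.2 (by linarith)⟩
  · rintro ⟨h0, h1⟩
    exact ⟨-Real.log r, by linarith [Real.log_neg h0 h1], by rw [neg_neg, Real.exp_log h0]⟩

theorem hasDerivWithinAt_exp_neg (s : Set ℝ) (x : ℝ) :
    HasDerivWithinAt (fun x : ℝ => Real.exp (-x)) (-Real.exp (-x)) s x := by
  simpa using ((hasDerivAt_neg x).exp).hasDerivWithinAt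

theorem injOn_exp_neg (s : Set ℝ) : Set.InjOn (fun x : ℝ => Real.exp (-x)) s :=
  fun _ _ _ _ h => neg_injective (Real.exp_injective h)

theorem integrableOn_neg_log_rpow {p : ℝ} (hp : 0 < p + 1) :
    IntegrableOn (fun r : ℝ => (-Real.log r) ^ p) (Set.Ioo 0 1) := by
  rw [← image_exp_neg_Ioi_zero, integrableOn_image_iff_integrableOn_abs_deriv_smul
    measurableSet_Ioi (fun x _ => hasDerivWithinAt_exp_neg _ x) (injOn_exp_neg _)]
  simpa [abs_of_pos, Real.exp_pos] using Real.GammaIntegral_convergent hp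

theorem integral_neg_log_rpow {p : ℝ} (hp : 0 < p + 1) :
    ∫ r in Set.Ioo (0 : ℝ) 1, (-Real.log r) ^ p = Real.Gamma (p + 1) := by
  rw [← image_exp_neg_Ioi_zero, integral_image_eq_integral_abs_deriv_smul
    measurableSet_Ioi (fun x _ => hasDerivWithinAt_exp_neg _ x) (injOn_exp_neg _),
    Real.Gamma_eq_integral hp]
  simp

theorem integrableOn_one_sub_rpow {q : ℝ} (hq : -1 < q) :
    IntegrableOn (fun r : ℝ => (1 - r) ^ q) (Set.Ioo 0 1) := by
  have h := ((intervalIntegral.intervalIntegrable_rpow' (a := 0) (b := 1) hq).comp_sub_left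
    (1 : ℝ)).symm
  simp only [sub_zero, sub_self] at h
  exact (intervalIntegrable_iff_integrableOn_Ioo_of_le zero_le_one).1 h

theorem integral_one_sub_rpow {q : ℝ} (hq : -1 < q) :
    ∫ r in Set.Ioo (0 : ℝ) 1, (1 - r) ^ q = 1 / (q + 1) := by
  rw [← integral_Ioc_eq_integral_Ioo, ← intervalIntegral.integral_of_le zero_le_one,
    intervalIntegral.integral_comp_sub_left (fun x : ℝ => x ^ q), integral_rpow (Or.inl hq)]
  simp [Real.zero_rpow (by linarith : q + 1 ≠ 0)]

theorem one_sub_rpow_le_mul_neg_log {r : ℝ} (hr : 0 < r) (c : ℝ) :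
    1 - r ^ c ≤ c * -Real.log r := by
  rw [Real.rpow_def_of_pos hr]
  linarith [Real.add_one_le_exp (Real.log r * c)]

theorem neg_log_le_two_mul_log_two_mul {r : ℝ} (h : 1 / 2 ≤ r) (h1 : r ≤ 1) :
    -Real.log r ≤ 2 * Real.log 2 * (1 - r) := by
  have key := strictConcaveOn_log_Ioi.concaveOn.2
    (show (1 / 2 : ℝ) ∈ Set.Ioi 0 by norm_num) (show (1 : ℝ) ∈ Set.Ioi 0 by norm_num)
    (show 0 ≤ 2 * (1 - r) by linarith) (show 0 ≤ 2 * r - 1 by linarith) (by ring)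
  simp only [smul_eq_mul, Real.log_one, mul_zero, add_zero, one_div, Real.log_inv] at key
  rw [show 2 * (1 - r) * (2 : ℝ)⁻¹ + (2 * r - 1) * 1 = r by ring] at key
  linarith

theorem neg_log_rpow_div_le {r a p : ℝ} (h0 : 0 < r) (h1 : r < 1) (ha : 0 ≤ a) (hp : 0 ≤ p) :
    (-Real.log r) ^ p / (1 - r) ^ a ≤
      2 ^ a * (-Real.log r) ^ p + (2 * Real.log 2) ^ p * (1 - r) ^ (p - a) := by
  have hs : 0 < 1 - r := by linarith
  have hl : 0 ≤ -Real.log r := by linarith [Real.log_neg h0 h1]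
  have hL : 0 ≤ 2 * Real.log 2 := by positivity
  rcases le_total (1 / 2) r with h | h
  · have hle : (-Real.log r) ^ p / (1 - r) ^ a ≤ (2 * Real.log 2) ^ p * (1 - r) ^ (p - a) := by
      rw [Real.rpow_sub hs, ← mul_div_assoc, ← Real.mul_rpow hL hs.le]
      gcongr
      exact neg_log_le_two_mul_log_two_mul h h1.le
    have : 0 ≤ 2 ^ a * (-Real.log r) ^ p := by positivity
    linarith
  · have hle : (-Real.log r) ^ p / (1 - r) ^ a ≤ 2 ^ a * (-Real.log r) ^ p := by
      rw [div_le_iff₀ (by positivity), mul_right_comm, ← Real.mul_rpow zero_le_two hs.le]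
      exact le_mul_of_one_le_left (by positivity) (Real.one_le_rpow (by linarith) ha)
    have : 0 ≤ (2 * Real.log 2) ^ p * (1 - r) ^ (p - a) := by positivity
    linarith

theorem abs_one_sub_rpow_rpow_le {r c p : ℝ} (h0 : 0 < r) (h1 : r < 1) (hc : 0 ≤ c)
    (hp : 0 ≤ p) : |1 - r ^ c| ^ p ≤ c ^ p * (-Real.log r) ^ p := by
  rw [abs_of_nonneg (by linarith [Real.rpow_le_one h0.le h1.le hc]),
    ← Real.mul_rpow hc (by linarith [Real.log_neg h0 h1])]
  exact Real.rpow_le_rpow (by linarith [Real.rpow_le_one h0.le h1.le hc])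
    (one_sub_rpow_le_mul_neg_log h0 c) hp

/-- the non-asymptotical upper bound (the choice `Δ = 1/2`):
`L_α(p) ≤ ((α−1)^p/p^p)·[2^{1+α}Γ(p+1) + (2 ln 2)^p/(p−α)]` for `p > α > 1`. -/
theorem Lfun_upper_estimate (α p : ℝ) (hα : 1 < α) (hp : α < p) :
    Lfun α p ≤ ((α - 1) ^ p / p ^ p) *
      (2 ^ (1 + α) * Real.Gamma (p + 1) + (2 * Real.log 2) ^ p / (p - α)) := by
  have hp0 : 0 < p := by linarith
  have hc : 0 ≤ (α - 1) / p := div_nonneg (by linarith) hp0.le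
  have hq : -1 < p - (1 + α) := by linarith
  have hint₁ := (integrableOn_neg_log_rpow (by linarith : 0 < p + 1)).const_mul (2 ^ (1 + α))
  have hint₂ := (integrableOn_one_sub_rpow hq).const_mul ((2 * Real.log 2) ^ p)
  calc Lfun α p
      ≤ ∫ r in Set.Ioo (0 : ℝ) 1, ((α - 1) / p) ^ p *
          (2 ^ (1 + α) * (-Real.log r) ^ p
            + (2 * Real.log 2) ^ p * (1 - r) ^ (p - (1 + α))) := by
        refine integral_mono_of_nonneg ?_ ((hint₁.add hint₂).const_mul _) ?_
        · filter_upwards [ae_restrict_mem measurableSet_Ioo] with r hr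
          have : 0 < 1 - r := by linarith [hr.2]
          simp only [Pi.zero_apply]
          positivity
        · filter_upwards [ae_restrict_mem measurableSet_Ioo] with r ⟨h0, h1⟩
          have hs : 0 < 1 - r := by linarith
          calc |1 - r ^ ((α - 1) / p)| ^ p / (1 - r) ^ (1 + α)
              ≤ ((α - 1) / p) ^ p * (-Real.log r) ^ p / (1 - r) ^ (1 + α) := by
                gcongr
                exact abs_one_sub_rpow_rpow_le h0 h1 hc hp0.le
            _ ≤ _ := by
                rw [mul_div_assoc]
                gcongr
                exact neg_log_rpow_div_le h0 h1 (by linarith) hp0.le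
    _ = _ := by
        rw [integral_const_mul, integral_add hint₁ hint₂, integral_const_mul,
          integral_const_mul, integral_neg_log_rpow (by linarith), integral_one_sub_rpow hq,
          Real.div_rpow (by linarith) hp0.le, mul_one_div,
          show p - (1 + α) + 1 = p - α by ring]
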